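/- Kernel bias bound: let k be a kernel of order m supported on [−1,1] (∫k = 1 and ∫ s^j k(s) ds = 0 for j = 1,…,m−1), let K(x) = ∫_x^1 k(s)ds, and let X be a real random variable whose density g is m-times continuously differentiable with |g^{(j)}| ≤ C on ℝ for j = 0,…,m, and P(X ≤ a) = τ. Then |E[τ − K((X−a)/h) + ((X−a)/h)·k((X−a)/h)]| ≤ C'·h^m for some constant C' depending only on C, m, and k, i.e., the expectation of the smoothed check derivative E[ϱ_τ'(X − a)] is O(h^m). -/

import Mathlib

open MeasureTheory

lemma kbb_taylor (C a : ℝ) (n : ℕ) : ∀ (f : ℝ → ℝ), ContDiff ℝ n f →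
    (∀ x, |iteratedDeriv n f x| ≤ C) → ∀ y : ℝ,
    |f (a + y) - ∑ j ∈ Finset.range n, iteratedDeriv j f a / (j.factorial : ℝ) * y ^ j|
      ≤ C * |y| ^ n := by
  induction n with
  | zero => intro f _ hb y; simpa using hb (a + y)
  | succ n ih =>
    intro f hf hb y
    have hC : 0 ≤ C := (abs_nonneg _).trans (hb 0)
    have hf' : ContDiff ℝ n (deriv f) := by
      have := (contDiff_succ_iff_deriv (n := n) (f := f)).1 (by exact_mod_cast hf)
      exact this.2.2
    have hd : Differentiable ℝ f := hf.differentiable (by simp)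
    have ih' := ih (deriv f) hf' (fun x => by rw [← iteratedDeriv_succ']; exact hb x)
    set F : ℝ → ℝ := fun y => f (a + y) -
      ∑ j ∈ Finset.range (n+1), iteratedDeriv j f a / (j.factorial : ℝ) * y ^ j with hF
    have hder : ∀ z, HasDerivAt F (deriv f (a + z) -
        ∑ j ∈ Finset.range n, iteratedDeriv j (deriv f) a / (j.factorial : ℝ) * z ^ j) z := by
      intro z
      have h1 : HasDerivAt (fun y => f (a + y)) (deriv f (a + z)) z :=
        (hd (a + z)).hasDerivAt.comp_const_add a z
      have h2 : HasDerivAt (fun y : ℝ => ∑ j ∈ Finset.range (n+1),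
          iteratedDeriv j f a / (j.factorial : ℝ) * y ^ j)
          (∑ j ∈ Finset.range (n+1),
          iteratedDeriv j f a / (j.factorial : ℝ) * (j * z ^ (j-1))) z := by
        apply HasDerivAt.fun_sum
        intro j _
        exact (hasDerivAt_pow j z).const_mul _
      have h3 := h1.sub h2
      refine h3.congr_deriv ?_
      congr 1
      rw [Finset.sum_range_succ']
      simp only [Nat.cast_zero, zero_mul, mul_zero, add_zero]
      symm
      apply Finset.sum_congr rfl
      intro j _
      rw [iteratedDeriv_succ', Nat.factorial_succ]
      have : (j.factorial : ℝ) ≠ 0 := by positivity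
      have : ((j:ℝ) + 1) ≠ 0 := by positivity
      push_cast
      try simp only [Nat.add_sub_cancel]
      field_simp
    have hF0 : F 0 = 0 := by
      simp [hF, Finset.sum_range_succ']
    have := (convex_Icc (-|y|) |y|).norm_image_sub_le_of_norm_hasDerivWithin_le
      (f := F) (C := C * |y| ^ n) (x := 0) (y := y)
      (fun z _ => (hder z).hasDerivWithinAt) (fun z hz => by
        rw [Real.norm_eq_abs]
        refine (ih' z).trans ?_
        have : |z| ≤ |y| := abs_le.2 hz
        gcongr) (by simp) (by simp [neg_abs_le, le_abs_self])
    rw [hF0, sub_zero, sub_zero, Real.norm_eq_abs, Real.norm_eq_abs] at this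
    rw [pow_succ, ← mul_assoc]
    exact this

lemma kbb_phi (C : ℝ) (hC : 0 ≤ C) (n : ℕ) (g : ℝ → ℝ) (hg : Continuous g) (a : ℝ) (c : ℕ → ℝ)
    (hR : ∀ y, |g (a + y) - ∑ j ∈ Finset.range n, c j * y ^ j| ≤ C * |y| ^ n) (y : ℝ) :
    |(y * g (a + y) - ∫ t in (0:ℝ)..y, g (a + t)) -
      ∑ j ∈ Finset.range n, c j * (1 - 1 / ((j:ℝ) + 1)) * y ^ (j + 1)| ≤ 2 * C * |y| ^ (n + 1) := by
  have hga : Continuous fun t => g (a + t) := by fun_prop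
  have hP : Continuous fun t : ℝ => ∑ j ∈ Finset.range n, c j * t ^ j := by fun_prop
  have h1 : ∫ t in (0:ℝ)..y, ∑ j ∈ Finset.range n, c j * t ^ j
      = ∑ j ∈ Finset.range n, c j * (y ^ (j+1) / ((j:ℝ) + 1)) := by
    rw [intervalIntegral.integral_finsetSum]
    · simp [integral_pow]
    · intro j _
      exact (by fun_prop : Continuous fun t : ℝ => c j * t ^ j).intervalIntegrable _ _
  have h2 : |∫ t in (0:ℝ)..y, (g (a + t) - ∑ j ∈ Finset.range n, c j * t ^ j)|
      ≤ C * |y| ^ n * |y| := by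
    have := intervalIntegral.norm_integral_le_of_norm_le_const (a := 0) (b := y)
      (f := fun t => g (a + t) - ∑ j ∈ Finset.range n, c j * t ^ j) (C := C * |y| ^ n) (by
        intro t ht
        rw [Real.norm_eq_abs]
        refine (hR t).trans ?_
        have : |t| ≤ |y| := by
          have := Set.abs_sub_left_of_mem_uIcc (Set.uIoc_subset_uIcc ht)
          simpa using this
        gcongr)
    simpa using this
  rw [intervalIntegral.integral_sub (hga.intervalIntegrable _ _) (hP.intervalIntegrable _ _), h1] at h2
  have h3 : |y * (g (a + y) - ∑ j ∈ Finset.range n, c j * y ^ j)| ≤ |y| * (C * |y| ^ n) := by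
    rw [abs_mul]; gcongr; exact hR y
  have h4 : (y * g (a + y) - ∫ t in (0:ℝ)..y, g (a + t)) -
      ∑ j ∈ Finset.range n, c j * (1 - 1 / ((j:ℝ) + 1)) * y ^ (j + 1)
      = y * (g (a + y) - ∑ j ∈ Finset.range n, c j * y ^ j) -
        ((∫ t in (0:ℝ)..y, g (a + t)) - ∑ j ∈ Finset.range n, c j * (y ^ (j+1) / ((j:ℝ) + 1))) := by
    have : ∑ j ∈ Finset.range n, c j * (1 - 1 / ((j:ℝ) + 1)) * y ^ (j + 1)
        = y * ∑ j ∈ Finset.range n, c j * y ^ j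
          - ∑ j ∈ Finset.range n, c j * (y ^ (j+1) / ((j:ℝ) + 1)) := by
      rw [Finset.mul_sum, ← Finset.sum_sub_distrib]
      apply Finset.sum_congr rfl
      intro j _
      ring
    rw [this]; ring
  rw [h4]
  refine (abs_sub _ _).trans ?_
  rw [pow_succ]
  linarith

lemma kbb_cs (k : ℝ → ℝ) (hsupp : ∀ x, x ∉ Set.Icc (-1:ℝ) 1 → k x = 0) (f : ℝ → ℝ) :
    HasCompactSupport fun s => k s * f s :=
  HasCompactSupport.intro (isCompact_Icc (a := (-1:ℝ)) (b := 1))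
    (fun x hx => by simp [hsupp x hx])

lemma kbb_int (k : ℝ → ℝ) (hk : Continuous k)
    (hsupp : ∀ x, x ∉ Set.Icc (-1:ℝ) 1 → k x = 0) (f : ℝ → ℝ) (hf : Continuous f) :
    Integrable fun s => k s * f s :=
  (hk.mul hf).integrable_of_hasCompactSupport (kbb_cs k hsupp f)

lemma kbb_moment (n : ℕ) (k : ℝ → ℝ) (hk : Continuous k)
    (hsupp : ∀ x, x ∉ Set.Icc (-1:ℝ) 1 → k x = 0)
    (hmom : ∀ j, 1 ≤ j → j ≤ n → (∫ x, x ^ j * k x) = 0)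
    (D h : ℝ) (hD : 0 ≤ D) (hh : 0 < h) (φ : ℝ → ℝ) (hφ : Continuous φ) (d : ℕ → ℝ)
    (hb : ∀ y, |φ y - ∑ j ∈ Finset.range n, d j * y ^ (j + 1)| ≤ D * |y| ^ (n + 1)) :
    |∫ s, k s * φ (h * s)| ≤ (D * ∫ s, |k s|) * h ^ (n + 1) := by
  have hki : Integrable k := by simpa using kbb_int k hk hsupp (fun _ => 1) continuous_const
  have h0 : ∫ s, k s * (∑ j ∈ Finset.range n, d j * (h * s) ^ (j + 1)) = 0 := by
    simp_rw [Finset.mul_sum]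
    rw [integral_finsetSum]
    · apply Finset.sum_eq_zero
      intro j hj
      have : ∀ s, k s * (d j * (h * s) ^ (j + 1)) = (d j * h ^ (j+1)) * (s ^ (j+1) * k s) := by
        intro s; ring
      simp_rw [this]
      rw [integral_const_mul, hmom (j+1) (by omega) (by have := Finset.mem_range.1 hj; omega), mul_zero]
    · intro j _
      exact kbb_int k hk hsupp _ (by fun_prop)
  have h1 : ∫ s, k s * φ (h * s) =
      ∫ s, k s * (φ (h * s) - ∑ j ∈ Finset.range n, d j * (h * s) ^ (j + 1)) := by
    simp_rw [mul_sub]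
    rw [integral_sub (kbb_int k hk hsupp _ (by fun_prop)) (kbb_int k hk hsupp _ (by fun_prop)), h0,
      sub_zero]
  rw [h1, ← Real.norm_eq_abs]
  have : (D * ∫ s, |k s|) * h ^ (n + 1) = ∫ s, (D * h ^ (n+1)) * |k s| := by
    rw [integral_const_mul]; ring
  rw [this]
  apply norm_integral_le_of_norm_le (hki.abs.const_mul _)
  refine Filter.Eventually.of_forall fun s => ?_
  rw [Real.norm_eq_abs, abs_mul]
  by_cases hs : s ∈ Set.Icc (-1:ℝ) 1
  · have hs1 : |s| ≤ 1 := abs_le.2 hs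
    have h2 := hb (h * s)
    have h3 : |h * s| ≤ h := by
      rw [abs_mul, abs_of_pos hh]; nlinarith
    have h4 : D * |h * s| ^ (n+1) ≤ D * h ^ (n+1) := by gcongr
    rw [mul_comm]
    exact mul_le_mul_of_nonneg_right (h2.trans h4) (abs_nonneg _)
  · simp [hsupp s hs]

lemma kbb_K (k : ℝ → ℝ) (hki : Integrable k)
    (hsupp : ∀ x, x ∉ Set.Icc (-1:ℝ) 1 → k x = 0) (u : ℝ) :
    (∫ s in u..1, k s) = ∫ s, (Set.Ioi u).indicator k s := by
  rw [← intervalIntegral.integral_Ioi_sub_Ioi' hki.integrableOn hki.integrableOn,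
    integral_indicator measurableSet_Ioi]
  have : ∫ x in Set.Ioi (1:ℝ), k x = 0 := by
    apply setIntegral_eq_zero_of_forall_eq_zero
    intro x hx
    exact hsupp x (fun h => absurd h.2 (not_le.2 hx))
  rw [this, sub_zero]

lemma kbb_identity (k : ℝ → ℝ) (hk : Continuous k)
    (hsupp : ∀ x, x ∉ Set.Icc (-1:ℝ) 1 → k x = 0)
    (hint : (∫ x, k x) = 1) (g : ℝ → ℝ) (a τ : ℝ) (hg0 : ∀ x, 0 ≤ g x) (hg : Continuous g)
    (hprob : IsProbabilityMeasure (volume.withDensity fun x => ENNReal.ofReal (g x)))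
    (hτ : (volume.withDensity fun x => ENNReal.ofReal (g x)) (Set.Iic a) = ENNReal.ofReal τ)
    (hτ0 : 0 < τ) (h : ℝ) (hh : 0 < h) :
    ∫ x, (τ - (∫ s in ((x - a) / h)..1, k s) + ((x - a) / h) * k ((x - a) / h))
            ∂(volume.withDensity fun x => ENNReal.ofReal (g x)) =
    ∫ s, k s * ((h * s) * g (a + h * s) - ∫ t in (0:ℝ)..(h * s), g (a + t)) := by
  set μ := volume.withDensity fun x => ENNReal.ofReal (g x) with hμ
  have hki : Integrable k := by simpa using kbb_int k hk hsupp (fun _ => 1) continuous_const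
  have hgi : Integrable g := by
    rw [← lintegral_ofReal_ne_top_iff_integrable hg.aestronglyMeasurable
      (Filter.Eventually.of_forall hg0)]
    have := hprob.measure_univ
    rw [hμ, withDensity_apply _ MeasurableSet.univ, Measure.restrict_univ] at this
    rw [this]; simp
  have hmeas : ∀ S : Set ℝ, MeasurableSet S → μ.real S = ∫ x in S, g x := by
    intro S hS
    rw [Measure.real, hμ, withDensity_apply _ hS, ← ofReal_integral_eq_lintegral_ofReal
      hgi.integrableOn (Filter.Eventually.of_forall hg0), ENNReal.toReal_ofReal]
    exact integral_nonneg hg0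
  have hτ' : ∫ x in Set.Iic a, g x = τ := by
    rw [← hmeas _ measurableSet_Iic, Measure.real, hτ, ENNReal.toReal_ofReal hτ0.le]
  have hcdf : ∀ s, μ.real (Set.Iio (a + h * s)) = τ + ∫ t in (0:ℝ)..(h * s), g (a + t) := by
    intro s
    rw [hmeas _ measurableSet_Iio, ← integral_Iic_eq_integral_Iio, ← hτ',
      intervalIntegral.integral_comp_add_left (fun x => g x) a, add_zero,
      ← intervalIntegral.integral_Iic_sub_Iic hgi.integrableOn hgi.integrableOn]
    ring
  -- Fubini
  set f : ℝ → ℝ → ℝ := fun x s => (Set.Ioi ((x - a) / h)).indicator k s with hf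
  have hfi : Integrable (Function.uncurry f) (μ.prod volume) := by
    have hS : MeasurableSet {p : ℝ × ℝ | (p.1 - a) / h < p.2} :=
      measurableSet_lt (by fun_prop) (by fun_prop)
    have h1 : Integrable (fun p : ℝ × ℝ => k p.2) (μ.prod volume) := hki.comp_snd μ
    have h2 := h1.indicator hS
    exact h2.congr (Filter.Eventually.of_forall fun p => rfl)
  have hKi : Integrable (fun x => ∫ s in ((x - a) / h)..1, k s) μ := by
    have := hfi.integral_prod_left
    refine this.congr (Filter.Eventually.of_forall fun x => ?_)
    simp only [Function.uncurry, hf]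
    exact (kbb_K k hki hsupp _).symm
  have hK : ∫ x, (∫ s in ((x - a) / h)..1, k s) ∂μ =
      ∫ s, k s * (τ + ∫ t in (0:ℝ)..(h * s), g (a + t)) := by
    simp_rw [kbb_K k hki hsupp]
    rw [integral_integral_swap hfi]
    congr 1
    ext s
    have : (fun x => f x s) = (Set.Iio (a + h * s)).indicator (fun _ => k s) := by
      ext x
      have : (x - a) / h < s ↔ x < a + h * s := by
        rw [div_lt_iff₀ hh]; constructor <;> intro <;> linarith
      simp only [hf, Set.indicator, Set.mem_Ioi, Set.mem_Iio, this]
    change ∫ x, (fun x => f x s) x ∂μ = _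
    rw [this, integral_indicator_const _ measurableSet_Iio, hcdf, smul_eq_mul, mul_comm]
  have huk : Continuous fun x => ((x - a) / h) * k ((x - a) / h) := by fun_prop
  have huki : Integrable (fun x => ((x - a) / h) * k ((x - a) / h)) μ := by
    apply huk.integrable_of_hasCompactSupport
    apply HasCompactSupport.intro (isCompact_Icc (a := a - h) (b := a + h))
    intro x hx
    rw [hsupp, mul_zero]
    intro hx'
    apply hx
    rw [Set.mem_Icc, le_div_iff₀ hh, div_le_iff₀ hh] at hx'
    constructor <;> linarith [hx'.1, hx'.2]
  have hU : ∫ x, ((x - a) / h) * k ((x - a) / h) ∂μ = ∫ s, k s * ((h * s) * g (a + h * s)) := by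
    rw [hμ, integral_withDensity_eq_integral_toReal_smul (by fun_prop) (by simp)]
    set G : ℝ → ℝ := fun x => g x * (((x - a) / h) * k ((x - a) / h)) with hG
    have e1 : ∀ x, (ENNReal.ofReal (g x)).toReal • (((x - a) / h) * k ((x - a) / h)) = G x := by
      intro x; rw [ENNReal.toReal_ofReal (hg0 x), smul_eq_mul]
    simp_rw [e1]
    have e2 := Measure.integral_comp_mul_left (fun y => G (a + y)) h
    rw [integral_add_left_eq_self G a, abs_of_pos (inv_pos.2 hh), smul_eq_mul] at e2
    have e3 : ∫ x, G x = h * ∫ s, G (a + h * s) := by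
      rw [e2]; field_simp
    rw [e3, ← integral_const_mul]
    congr 1
    ext s
    simp only [hG]
    have : (a + h * s - a) / h = s := by field_simp; ring
    rw [this]; ring
  have hc1 : Continuous fun s => ∫ t in (0:ℝ)..(h * s), g (a + t) := by
    have := intervalIntegral.continuous_primitive (μ := volume) (f := fun t => g (a + t))
      (fun _ _ => (by fun_prop : Continuous fun t => g (a + t)).intervalIntegrable _ _) 0
    exact this.comp (continuous_const.mul continuous_id)
  have hsub : Integrable (fun x => τ - ∫ s in ((x - a) / h)..1, k s) μ :=
    (integrable_const τ).sub hKi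
  rw [integral_add hsub huki, integral_sub (integrable_const _) hKi, hK, hU]
  simp_rw [mul_add, mul_sub]
  rw [integral_add (hki.mul_const _) (kbb_int k hk hsupp _ hc1),
    integral_sub (kbb_int k hk hsupp _ (by fun_prop)) (kbb_int k hk hsupp _ hc1),
    integral_mul_const, hint]
  simp
  ring

/-- Kernel bias bound: for an order-`m` kernel `k` supported in `[−1,1]` and a random variable
with an `m`-times continuously differentiable density `g` with derivatives bounded by `C`,
and `P(X ≤ a) = τ`, the expectation of the smoothed check derivative is `O(hᵐ)`, with a
constant depending only on `C`, `m` and `k`. -/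
theorem kernel_bias_bound (m : ℕ) (hm : 1 ≤ m) (k : ℝ → ℝ) (hk : Continuous k)
    (hsupp : ∀ x, x ∉ Set.Icc (-1:ℝ) 1 → k x = 0)
    (hint : (∫ x, k x) = 1)
    (hmom : ∀ j, 1 ≤ j → j ≤ m - 1 → (∫ x, x ^ j * k x) = 0)
    (C : ℝ) :
    ∃ C' : ℝ, ∀ (g : ℝ → ℝ) (a τ : ℝ), (∀ x, 0 ≤ g x) → ContDiff ℝ m g →
      (∀ j ≤ m, ∀ x, |iteratedDeriv j g x| ≤ C) →
      IsProbabilityMeasure (volume.withDensity fun x => ENNReal.ofReal (g x)) →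
      (volume.withDensity fun x => ENNReal.ofReal (g x)) (Set.Iic a) = ENNReal.ofReal τ →
      τ ∈ Set.Ioo (0:ℝ) 1 →
      ∀ h : ℝ, 0 < h →
        |∫ x, (τ - (∫ s in ((x - a) / h)..1, k s) + ((x - a) / h) * k ((x - a) / h))
            ∂(volume.withDensity fun x => ENNReal.ofReal (g x))| ≤ C' * h ^ m := by
  obtain ⟨n, rfl⟩ : ∃ n, m = n + 1 := ⟨m - 1, by omega⟩
  refine ⟨2 * C * ∫ s, |k s|, ?_⟩
  intro g a τ hg0 hg hb hprob hτ hτ01 h hh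
  have hC : 0 ≤ C := (abs_nonneg _).trans (hb 0 (by omega) 0)
  have hgc : Continuous g := hg.continuous
  rw [kbb_identity k hk hsupp hint g a τ hg0 hgc hprob hτ hτ01.1 h hh]
  have hT := kbb_taylor C a n g (hg.of_le (by exact_mod_cast Nat.le_succ n)) (hb n (by omega))
  have hφ := kbb_phi C hC n g hgc a (fun j => iteratedDeriv j g a / (j.factorial : ℝ)) hT
  have hga : Continuous fun t => g (a + t) := by fun_prop
  have hc1 : Continuous fun y => ∫ t in (0:ℝ)..y, g (a + t) :=
    intervalIntegral.continuous_primitive (fun _ _ => hga.intervalIntegrable _ _) 0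
  exact kbb_moment n k hk hsupp (fun j h1 h2 => hmom j h1 (by omega)) (2 * C) h (by positivity) hh
    (fun y => y * g (a + y) - ∫ t in (0:ℝ)..y, g (a + t)) (by fun_prop) _ hφ
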